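/- Let H be an elementary abelian 2-hypergroup built from p involutions, p♯ of which are thick, and let G be a closed subset of H. Then G = O^ϑ(G)·O_ϑ(G), O^ϑ(G) ∩ O_ϑ(G) = {e}, and |G| = |O^ϑ(G)|·|O_ϑ(G)| = 2^{s(G)+r_2(G)}. In particular, H = O^ϑ(H)·O_ϑ(H), O^ϑ(H) ∩ O_ϑ(H) = {e}, s(H) = p♯, and r_2(H) = p − p♯. -/

import Mathlib

namespace HyperPaper

/-- A hypergroup: hypermultiplication `hmul`, inversion `star`, identity `e`,
satisfying (H1) associativity, (H2) unique two-sided identity, (H3) exchange conditions. -/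
structure Hypergroup (H : Type*) where
  hmul : H → H → Set H
  star : H → H
  e : H
  idl : ∀ p, hmul e p = {p}
  idr : ∀ p, hmul p e = {p}
  e_unique : ∀ e' : H, (∀ p, hmul e' p = {p} ∧ hmul p e' = {p}) → e' = e
  assoc : ∀ p q r : H, (⋃ x ∈ hmul p q, hmul x r) = ⋃ x ∈ hmul q r, hmul p x
  h3l : ∀ p q r : H, p ∈ hmul q r ↔ q ∈ hmul p (star r)
  h3r : ∀ p q r : H, p ∈ hmul q r ↔ r ∈ hmul (star q) p

variable {H : Type*}

namespace Hypergroup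

/-- Product of two subsets: FG = {a : ∃ b ∈ F, c ∈ G, a ∈ bc}. -/
def smul (hg : Hypergroup H) (F G : Set H) : Set H :=
  {a | ∃ b ∈ F, ∃ c ∈ G, a ∈ hg.hmul b c}

/-- Closed subset: nonempty and G*G ⊆ G. -/
def IsClosed (hg : Hypergroup H) (G : Set H) : Prop :=
  G.Nonempty ∧ hg.smul (hg.star '' G) G ⊆ G

/-- Thin element: p*p = {e}. -/
def IsThin (hg : Hypergroup H) (p : H) : Prop := hg.hmul (hg.star p) p = {hg.e}

/-- Thick element: not thin. -/
def IsThick (hg : Hypergroup H) (p : H) : Prop := ¬ hg.IsThin p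

/-- Involution: p ≠ e and {e, p} is closed. -/
def IsInvolution (hg : Hypergroup H) (p : H) : Prop :=
  p ≠ hg.e ∧ hg.IsClosed {hg.e, p}

/-- ⟨G⟩: smallest closed subset containing G. -/
def gen (hg : Hypergroup H) (G : Set H) : Set H := ⋂₀ {C | hg.IsClosed C ∧ G ⊆ C}

/-- O_ϑ(G): the thin elements of H lying in G. -/
def Othin (hg : Hypergroup H) (G : Set H) : Set H := {p ∈ G | hg.IsThin p}

/-- F is a strongly normal closed subset of G: p*Fp ⊆ F ⊆ G for all p ∈ G. -/
def IsStronglyNormal (hg : Hypergroup H) (F G : Set H) : Prop :=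
  hg.IsClosed F ∧ hg.IsClosed G ∧ F ⊆ G ∧
    ∀ p ∈ G, hg.smul (hg.smul {hg.star p} F) {p} ⊆ F

/-- O^ϑ(G): intersection of all strongly normal closed subsets of ⟨G⟩. -/
def Osup (hg : Hypergroup H) (G : Set H) : Set H :=
  ⋂₀ {F | hg.IsStronglyNormal F (hg.gen G)}

/-- F is a normal closed subset of G. -/
def IsNormal (hg : Hypergroup H) (F G : Set H) : Prop :=
  hg.IsClosed F ∧ hg.IsClosed G ∧ F ⊆ G ∧ ∀ p ∈ G, hg.smul F {p} = hg.smul {p} F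

/-- Product of a list of subsets (empty product is {e}). -/
def listProd (hg : Hypergroup H) : List (Set H) → Set H
  | [] => {hg.e}
  | a :: l => hg.smul a (hg.listProd l)

/-- Product r_1 r_2 ⋯ r_n of a family of elements. -/
def famProd (hg : Hypergroup H) {n : ℕ} (r : Fin n → H) : Set H :=
  hg.listProd ((List.finRange n).map fun i => ({r i} : Set H))

/-- Ĝ_i: the product of the G_j with j ≠ i. -/
def cofactor (hg : Hypergroup H) {n : ℕ} (G : Fin n → Set H) (i : Fin n) : Set H :=
  hg.listProd (((List.finRange n).filter fun j => decide (j ≠ i)).map G)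

/-- H is the direct product of the normal closed subsets G_1, …, G_n. -/
def IsDirectProduct (hg : Hypergroup H) {n : ℕ} (G : Fin n → Set H) : Prop :=
  (∀ i, hg.IsNormal (G i) Set.univ) ∧
  (∀ i, hg.smul (G i) (hg.cofactor G i) = Set.univ) ∧
  (∀ i, G i ∩ hg.cofactor G i = {hg.e})

/-- r : Fin n → H is a decomposition of x with respect to the family G. -/
def IsDecomp (hg : Hypergroup H) {n : ℕ} (G : Fin n → Set H) (x : H) (r : Fin n → H) : Prop :=
  (∀ i, r i ∈ G i) ∧ x ∈ hg.famProd r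

/-- The support of x: the elements ≠ e appearing in the decomposition of x. -/
def dsupport (hg : Hypergroup H) {n : ℕ} (G : Fin n → Set H) (x : H) : Set H :=
  {y | y ≠ hg.e ∧ ∃ r, hg.IsDecomp G x r ∧ y ∈ Set.range r}

/-- The cover of x: the product r_1r_2⋯r_n for the decomposition of x. -/
def dcover (hg : Hypergroup H) {n : ℕ} (G : Fin n → Set H) (x : H) : Set H :=
  {y | ∃ r, hg.IsDecomp G x r ∧ y ∈ hg.famProd r}

/-- x is constrained: its cover equals {x}. -/
def IsConstrained (hg : Hypergroup H) {n : ℕ} (G : Fin n → Set H) (x : H) : Prop :=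
  hg.dcover G x = {x}

/-- r_2(G): the largest 2-rank of a thin closed subset of H contained in G
(equivalently, the largest k such that G contains a thin symmetric closed subset
of 2^k elements, which corresponds to an elementary abelian 2-group of 2-rank k). -/
noncomputable def rank2 (hg : Hypergroup H) (G : Set H) : ℕ :=
  sSup {k | ∃ U : Set H, hg.IsClosed U ∧ U ⊆ G ∧ (∀ u ∈ U, hg.IsThin u) ∧
    (∀ u ∈ U, hg.star u = u) ∧ U.ncard = 2 ^ k}

/-- F is a minimal generating subset of G. -/
def IsMinGen (hg : Hypergroup H) (G F : Set H) : Prop :=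
  F ⊆ G ∧ hg.gen F = G ∧ ∀ p ∈ F, hg.gen (F \ {p}) ≠ G

/-- The dimension of G: the smallest cardinality of a minimal generating subset. -/
noncomputable def dimension (hg : Hypergroup H) (G : Set H) : ℕ :=
  sInf {k | ∃ F : Set H, hg.IsMinGen G F ∧ F.Finite ∧ F.ncard = k}

/-- [F, G] = ⟨{a : ∃ b ∈ F, c ∈ G, a ∈ b*c*bc}⟩. -/
def commSet (hg : Hypergroup H) (F G : Set H) : Set H :=
  hg.gen {a | ∃ b ∈ F, ∃ c ∈ G,
    a ∈ hg.smul (hg.smul (hg.smul {hg.star b} {hg.star c}) {b}) {c}}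

/-- derived G k = G^{(k+1)}: G^{(1)} = G, G^{(r)} = [G^{(r-1)}, G]. -/
def derived (hg : Hypergroup H) (G : Set H) : ℕ → Set H
  | 0 => G
  | k + 1 => hg.commSet (hg.derived G k) G

/-- G is nilpotent: G^{(r)} = {e} for some r. -/
def IsNilpotent (hg : Hypergroup H) (G : Set H) : Prop :=
  ∃ k : ℕ, hg.derived G k = {hg.e}

/-- G is a residually thin closed subset: there is a chain {e} = F_1, …, F_n = G of
pairwise distinct closed subsets, each strongly normal in the next. -/
def IsResiduallyThin (hg : Hypergroup H) (G : Set H) : Prop :=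
  ∃ (m : ℕ) (F : Fin (m + 1) → Set H), Function.Injective F ∧
    F 0 = {hg.e} ∧ F (Fin.last m) = G ∧
    ∀ i : Fin m, hg.IsStronglyNormal (F i.castSucc) (F i.succ)

/-- x^k as a subset: x^0 = {e}, x^{k+1} = x^k · x. -/
def spow (hg : Hypergroup H) (x : H) : ℕ → Set H
  | 0 => {hg.e}
  | k + 1 => hg.smul (hg.spow x k) {x}

/-- F is a maximal closed subset of G. -/
def IsMaximalClosed (hg : Hypergroup H) (F G : Set H) : Prop :=
  hg.IsClosed F ∧ hg.IsClosed G ∧ F ⊆ G ∧ F ≠ G ∧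
    ∀ E : Set H, hg.IsClosed E → F ⊆ E → E ⊆ G → E = F ∨ E = G

/-- The Frattini closed subset of G: the intersection (inside G) of all maximal
closed subsets of G. -/
def frattini (hg : Hypergroup H) (G : Set H) : Set H :=
  G ∩ ⋂₀ {F | hg.IsMaximalClosed F G}

/-- α is an isomorphism from the closed subset F to the closed subset G. -/
def IsIso (hg : Hypergroup H) (F G : Set H) (α : H → H) : Prop :=
  Set.BijOn α F G ∧ α hg.e = hg.e ∧
    ∀ p ∈ F, ∀ q ∈ F, α '' hg.hmul p q = hg.hmul (α p) (α q)

/-- F ≃ G: there is an isomorphism from F to G. -/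
def Isomorphic (hg : Hypergroup H) (F G : Set H) : Prop := ∃ α : H → H, hg.IsIso F G α

/-- Aut(G): the automorphism group of G, realized as the subgroup of permutations of G
that fix e and preserve the hypermultiplication. -/
def autGroup (hg : Hypergroup H) (G : Set H) : Subgroup (Equiv.Perm G) where
  carrier := {σ | (∀ x : G, (x : H) = hg.e → ((σ x : H)) = hg.e) ∧
    ∀ p q x : G, (x : H) ∈ hg.hmul p q ↔ ((σ x : H)) ∈ hg.hmul (σ p) (σ q)}
  one_mem' := by
    constructor
    · intro x hx; simpa using hx
    · intro p q x; simp
  mul_mem' := by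
    rintro σ τ ⟨he1, hm1⟩ ⟨he2, hm2⟩
    refine ⟨fun x hx => ?_, fun p q x => ?_⟩
    · simpa using he1 _ (he2 x hx)
    · simpa using (hm2 p q x).trans (hm1 (τ p) (τ q) (τ x))
  inv_mem' := by
    rintro σ ⟨he, hm⟩
    refine ⟨fun x hx => ?_, fun p q x => ?_⟩
    · have h2 : σ x = x := Subtype.ext ((he x hx).trans hx.symm)
      have h3 : σ⁻¹ x = x := by
        conv_lhs => rw [← h2]
        simp
      rw [h3]; exact hx
    · have h := hm (σ⁻¹ p) (σ⁻¹ q) (σ⁻¹ x)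
      simpa using h.symm

end Hypergroup

/-- An elementary abelian 2-hypergroup: a hypergroup that is the constrained direct
product of the closed subsets ⟨q_1⟩, …, ⟨q_n⟩ generated by involutions q_1, …, q_n. -/
structure EA2Data (H : Type*) where
  hg : Hypergroup H
  n : ℕ
  q : Fin n → H
  invol : ∀ i, hg.IsInvolution (q i)
  dp : hg.IsDirectProduct fun i => hg.gen {q i}
  constrained : ∀ x : H, hg.IsConstrained (fun i => hg.gen {q i}) x

namespace EA2Data

/-- The family ⟨q_1⟩, …, ⟨q_n⟩. -/
def fam (E : EA2Data H) : Fin E.n → Set H := fun i => E.hg.gen {E.q i}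

/-- The support of x. -/
def support (E : EA2Data H) (x : H) : Set H := E.hg.dsupport E.fam x

/-- Thick(F): externally thick elements of H lying in F. -/
def ThickIn (E : EA2Data H) (F : Set H) : Set H :=
  {x ∈ F | x = E.hg.e ∨ ∀ y ∈ E.support x, E.hg.IsThick y}

/-- Thin(F): externally thin elements of H lying in F. -/
def ThinIn (E : EA2Data H) (F : Set H) : Set H :=
  {x ∈ F | x = E.hg.e ∨ ∀ y ∈ E.support x, E.hg.IsThin y}

/-- The (unique) pair (x⁺, x⁻) with x⁺ ∈ Thick(H), x⁻ ∈ Thin(H), x⁺x⁻ = {x}. -/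
noncomputable def pm (E : EA2Data H) (x : H) : H × H :=
  @Classical.epsilon (H × H) ⟨(E.hg.e, E.hg.e)⟩ fun z =>
    z.1 ∈ E.ThickIn Set.univ ∧ z.2 ∈ E.ThinIn Set.univ ∧ E.hg.hmul z.1 z.2 = {x}

/-- x⁺. -/
noncomputable def plus (E : EA2Data H) (x : H) : H := (E.pm x).1

/-- x⁻. -/
noncomputable def minus (E : EA2Data H) (x : H) : H := (E.pm x).2

/-- s(x): the number of thick elements of H in the support of x. -/
noncomputable def sElem (E : EA2Data H) (x : H) : ℕ :=
  {y ∈ E.support x | E.hg.IsThick y}.ncard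

/-- s(G) = max {s(a) : a ∈ G}. -/
noncomputable def sSet (E : EA2Data H) (G : Set H) : ℕ :=
  sSup {k | ∃ a ∈ G, E.sElem a = k}

/-- x ⪯ y: the support of x is contained in the support of y. -/
def ple (E : EA2Data H) (x y : H) : Prop := E.support x ⊆ E.support y

/-- p♯: the number of thick elements among q_1, …, q_n. -/
noncomputable def psharp (E : EA2Data H) : ℕ := {i : Fin E.n | E.hg.IsThick (E.q i)}.ncard

end EA2Data

/-- The Gaussian binomial coefficient C(n, k)_2 with base 2, via the
q-Pascal recurrence C(n, k)_2 = C(n-1, k-1)_2 + 2^k · C(n-1, k)_2. -/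
def gaussBinom2 : ℕ → ℕ → ℕ
  | _, 0 => 1
  | 0, _ + 1 => 0
  | n + 1, k + 1 => gaussBinom2 n k + 2 ^ (k + 1) * gaussBinom2 n (k + 1)

end HyperPaper

namespace HyperPaper

namespace Hypergroup

variable {H : Type*} (hg : Hypergroup H)

theorem e_mem_hmul_star (p : H) : hg.e ∈ hg.hmul p (hg.star p) := by
  rw [← hg.h3l, hg.idl]; rfl

theorem e_mem_star_hmul (p : H) : hg.e ∈ hg.hmul (hg.star p) p := by
  rw [← hg.h3r, hg.idr]; rfl

theorem e_mem_hmul_iff (p q : H) : hg.e ∈ hg.hmul p q ↔ q = hg.star p := by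
  rw [hg.h3r, hg.idr]; rfl

theorem hmul_nonempty (p q : H) : (hg.hmul p q).Nonempty := by
  have h : p ∈ ⋃ x ∈ hg.hmul p q, hg.hmul x (hg.star q) := by
    rw [hg.assoc]
    exact Set.mem_biUnion (hg.e_mem_hmul_star q) (by rw [hg.idr]; rfl)
  obtain ⟨x, hx, -⟩ := Set.mem_iUnion₂.1 h
  exact ⟨x, hx⟩

theorem smul_assoc (A B C : Set H) :
    hg.smul (hg.smul A B) C = hg.smul A (hg.smul B C) := by
  ext x
  constructor
  · rintro ⟨y, ⟨a, ha, b, hb, hy⟩, c, hc, hx⟩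
    have h : x ∈ ⋃ z ∈ hg.hmul a b, hg.hmul z c := Set.mem_biUnion hy hx
    rw [hg.assoc] at h
    obtain ⟨z, hz, hxz⟩ := Set.mem_iUnion₂.1 h
    exact ⟨a, ha, z, ⟨b, hb, c, hc, hz⟩, hxz⟩
  · rintro ⟨a, ha, y, ⟨b, hb, c, hc, hy⟩, hx⟩
    have h : x ∈ ⋃ z ∈ hg.hmul b c, hg.hmul a z := Set.mem_biUnion hy hx
    rw [← hg.assoc] at h
    obtain ⟨z, hz, hxz⟩ := Set.mem_iUnion₂.1 h
    exact ⟨z, ⟨a, ha, b, hb, hz⟩, c, hc, hxz⟩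

theorem e_smul (A : Set H) : hg.smul {hg.e} A = A := by
  ext x; simp [smul, hg.idl]

theorem smul_e (A : Set H) : hg.smul A {hg.e} = A := by
  ext x; simp [smul, hg.idr]

theorem singleton_smul_singleton (a b : H) : hg.smul {a} {b} = hg.hmul a b := by
  ext x; simp [smul]

theorem smul_mono {A A' B B' : Set H} (hA : A ⊆ A') (hB : B ⊆ B') :
    hg.smul A B ⊆ hg.smul A' B' := by
  rintro x ⟨a, ha, b, hb, hx⟩
  exact ⟨a, hA ha, b, hB hb, hx⟩

variable {ι : Type*}

theorem smul_listProd_comm (A : Set H) (B : ι → Set H) (l : List ι)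
    (h : ∀ i ∈ l, hg.smul A (B i) = hg.smul (B i) A) :
    hg.smul A (hg.listProd (l.map B)) = hg.smul (hg.listProd (l.map B)) A := by
  induction l with
  | nil => simp [listProd, hg.e_smul, hg.smul_e]
  | cons i l ih =>
    simp only [List.map_cons, listProd]
    rw [← hg.smul_assoc, h i (by simp), hg.smul_assoc,
      ih fun j hj => h j (List.mem_cons_of_mem _ hj), hg.smul_assoc]

theorem listProd_smul_listProd (A B : ι → Set H) (l : List ι) (hl : l.Nodup)
    (h : ∀ i j, i ≠ j → hg.smul (B i) (A j) = hg.smul (A j) (B i)) :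
    hg.smul (hg.listProd (l.map A)) (hg.listProd (l.map B)) =
      hg.listProd (l.map fun i => hg.smul (A i) (B i)) := by
  induction l with
  | nil => simp [listProd, hg.e_smul]
  | cons i l ih =>
    obtain ⟨hi, hl⟩ := List.nodup_cons.1 hl
    simp only [List.map_cons, listProd]
    rw [← ih hl, hg.smul_assoc, hg.smul_assoc,
      ← hg.smul_assoc (hg.listProd (l.map A)) (B i),
      ← hg.smul_listProd_comm (B i) A l fun j hj => h i j fun hij => hi (hij ▸ hj),
      hg.smul_assoc]

theorem mem_listProd_iff [DecidableEq ι] (A : ι → Set H) (l : List ι) (hl : l.Nodup)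
    (hA : ∀ i, (A i).Nonempty) (x : H) :
    x ∈ hg.listProd (l.map A) ↔
      ∃ r : ι → H, (∀ i, r i ∈ A i) ∧ x ∈ hg.listProd (l.map fun i => {r i}) := by
  induction l generalizing x with
  | nil =>
    simp only [List.map_nil]
    exact ⟨fun h => ⟨fun i => (hA i).some, fun i => (hA i).some_mem, h⟩, fun ⟨_, _, h⟩ => h⟩
  | cons i l ih =>
    obtain ⟨hi, hl⟩ := List.nodup_cons.1 hl
    simp only [List.map_cons, listProd]
    constructor
    · rintro ⟨a, ha, b, hb, hx⟩
      obtain ⟨r, hr, hb⟩ := (ih hl b).1 hb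
      refine ⟨Function.update r i a, fun j => ?_, a, by simp, b, ?_, hx⟩
      · by_cases hj : j = i
        · subst hj; simpa using ha
        · simpa [hj] using hr j
      · have : (l.map fun j => ({Function.update r i a j} : Set H)) =
            l.map fun j => ({r j} : Set H) :=
          List.map_congr_left fun j hj => by
            have hji : j ≠ i := fun h => hi (h ▸ hj)
            rw [Function.update_of_ne hji]
        rwa [this]
    · rintro ⟨r, hr, a, rfl, b, hb, hx⟩
      exact ⟨r i, hr i, b, (ih hl b).2 ⟨r, hr, hb⟩, hx⟩

theorem listProd_mono {A B : ι → Set H} (l : List ι) (h : ∀ i, A i ⊆ B i) :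
    hg.listProd (l.map A) ⊆ hg.listProd (l.map B) := by
  induction l with
  | nil => exact subset_rfl
  | cons i l ih => exact hg.smul_mono (h i) ih

theorem listProd_nonempty (r : ι → H) (l : List ι) :
    (hg.listProd (l.map fun i => ({r i} : Set H))).Nonempty := by
  induction l with
  | nil => exact ⟨hg.e, rfl⟩
  | cons i l ih =>
    obtain ⟨y, hy⟩ := ih
    obtain ⟨x, hx⟩ := hg.hmul_nonempty (r i) y
    exact ⟨x, r i, rfl, y, hy, hx⟩

theorem e_mem_listProd (A : ι → Set H) (l : List ι) (h : ∀ i, hg.e ∈ A i) :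
    hg.e ∈ hg.listProd (l.map A) := by
  induction l with
  | nil => rfl
  | cons i l ih => exact ⟨hg.e, h i, hg.e, ih, by rw [hg.idl]; rfl⟩

theorem mem_listProd_of_mem (A : ι → Set H) (l : List ι) (h : ∀ i, hg.e ∈ A i) {j : ι}
    (hj : j ∈ l) {a : H} (ha : a ∈ A j) : a ∈ hg.listProd (l.map A) := by
  induction l with
  | nil => simp at hj
  | cons i l ih =>
    rcases List.mem_cons.1 hj with rfl | hj
    · exact ⟨a, ha, hg.e, hg.e_mem_listProd A l h, by rw [hg.idr]; rfl⟩
    · exact ⟨hg.e, h i, a, ih hj, by rw [hg.idl]; rfl⟩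

theorem listProd_eq_smul_filter [DecidableEq ι] (A : ι → Set H) (l : List ι) (hl : l.Nodup)
    (h : ∀ i j, i ≠ j → hg.smul (A i) (A j) = hg.smul (A j) (A i)) {i : ι} (hi : i ∈ l) :
    hg.listProd (l.map A) =
      hg.smul (A i) (hg.listProd ((l.filter fun j => decide (j ≠ i)).map A)) := by
  induction l with
  | nil => simp at hi
  | cons j l ih =>
    obtain ⟨hj, hl⟩ := List.nodup_cons.1 hl
    by_cases hji : j = i
    · subst hji
      have : (l.filter fun k => decide (k ≠ j)) = l :=
        List.filter_eq_self.2 fun k hk => by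
          simpa using fun hkj : k = j => hj (hkj ▸ hk)
      rw [List.filter_cons_of_neg (by simp), this]
      rfl
    · have hil : i ∈ l := (List.mem_cons.1 hi).resolve_left fun h => hji h.symm
      rw [List.filter_cons_of_pos (by simpa using hji)]
      simp only [List.map_cons, listProd]
      rw [ih hl hil, ← hg.smul_assoc, h j i hji, hg.smul_assoc]

variable {hg}

theorem IsClosed.star_hmul_subset {G : Set H} (hG : hg.IsClosed G) {a b : H} (ha : a ∈ G)
    (hb : b ∈ G) : hg.hmul (hg.star a) b ⊆ G :=
  fun _ hx => hG.2 ⟨_, ⟨a, ha, rfl⟩, b, hb, hx⟩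

theorem IsClosed.e_mem {G : Set H} (hG : hg.IsClosed G) : hg.e ∈ G := by
  obtain ⟨a, ha⟩ := hG.1
  exact hG.star_hmul_subset ha ha (hg.e_mem_star_hmul a)

theorem IsClosed.gen_eq {G : Set H} (hG : hg.IsClosed G) : hg.gen G = G :=
  Set.Subset.antisymm (fun _ hx => hx G ⟨hG, subset_rfl⟩)
    fun _ hx _ hC => hC.2 hx

theorem isClosed_univ : hg.IsClosed Set.univ :=
  ⟨⟨hg.e, trivial⟩, Set.subset_univ _⟩

theorem IsInvolution.gen_singleton {p : H} (hp : hg.IsInvolution p) :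
    hg.gen {p} = {hg.e, p} := by
  refine Set.Subset.antisymm (fun x hx => hx _ ⟨hp.2, by simp⟩) ?_
  rintro x (rfl | rfl) C ⟨hC, hpC⟩
  · exact hC.e_mem
  · exact hpC rfl

theorem IsInvolution.star_eq {p : H} (hp : hg.IsInvolution p) : hg.star p = p := by
  have h : hg.star p ∈ ({hg.e, p} : Set H) :=
    hp.2.star_hmul_subset (a := p) (b := hg.e) (by simp) (by simp) (by rw [hg.idr]; rfl)
  rcases h with h | h
  · have := hg.e_mem_star_hmul p
    rw [h, hg.idl] at this
    exact absurd this.symm hp.1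
  · exact h

theorem IsInvolution.hmul_self_subset {p : H} (hp : hg.IsInvolution p) :
    hg.hmul p p ⊆ {hg.e, p} := by
  have := hp.2.star_hmul_subset (a := p) (b := p) (by simp) (by simp)
  rwa [hp.star_eq] at this

theorem IsInvolution.mem_hmul_self_iff {p : H} (hp : hg.IsInvolution p) :
    p ∈ hg.hmul p p ↔ hg.IsThick p := by
  have he := hg.e_mem_star_hmul p
  rw [IsThick, IsThin, hp.star_eq]
  rw [hp.star_eq] at he
  constructor
  · intro h h'
    rw [h'] at h
    exact hp.1 h
  · intro h
    by_contra h'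
    refine h (Set.Subset.antisymm (fun x hx => ?_) (by simpa using he))
    rcases hp.hmul_self_subset hx with rfl | rfl
    · rfl
    · exact absurd hx h'

end Hypergroup

namespace EA2Data

open Hypergroup

variable {H : Type*} (E : EA2Data H)

theorem gen_singleton_q (i : Fin E.n) : E.hg.gen {E.q i} = {E.hg.e, E.q i} :=
  (E.invol i).gen_singleton

theorem q_notMem_cofactor (i : Fin E.n) :
    E.q i ∉ E.hg.cofactor (fun i => E.hg.gen {E.q i}) i := by
  intro h
  have : E.q i ∈ ({E.hg.e} : Set H) := by
    rw [← E.dp.2.2 i]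
    exact ⟨by simp [gen_singleton_q], h⟩
  exact (E.invol i).1 this

theorem q_injective : Function.Injective E.q := by
  intro i j hij
  by_contra hne
  refine E.q_notMem_cofactor i ?_
  rw [hij]
  exact E.hg.mem_listProd_of_mem _ _ (fun k => by rw [gen_singleton_q]; simp) (j := j)
    (by simpa using fun h : j = i => hne h.symm) (by rw [gen_singleton_q]; simp)

theorem q_notMem_hmul_q {i j : Fin E.n} (hij : i ≠ j) :
    E.q j ∉ E.hg.hmul (E.q i) (E.q j) := by
  rw [E.hg.h3l, (E.invol j).star_eq]
  intro h
  rcases (E.invol j).hmul_self_subset h with h | h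
  · exact (E.invol i).1 h
  · exact hij (E.q_injective h)

theorem q_notMem_q_hmul {i j : Fin E.n} (hij : i ≠ j) :
    E.q j ∉ E.hg.hmul (E.q j) (E.q i) := by
  rw [E.hg.h3r, (E.invol j).star_eq]
  intro h
  rcases (E.invol j).hmul_self_subset h with h | h
  · exact (E.invol i).1 h
  · exact hij (E.q_injective h)

theorem hmul_q_comm (i j : Fin E.n) :
    E.hg.hmul (E.q i) (E.q j) = E.hg.hmul (E.q j) (E.q i) := by
  rcases eq_or_ne i j with rfl | hij
  · rfl
  have h : E.hg.smul (E.hg.gen {E.q i}) {E.q j} = E.hg.smul {E.q j} (E.hg.gen {E.q i}) :=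
    (E.dp.1 i).2.2.2 (E.q j) trivial
  rw [gen_singleton_q] at h
  ext x
  have hx : x = E.q j ∨ x ∈ E.hg.hmul (E.q i) (E.q j) ↔
      x = E.q j ∨ x ∈ E.hg.hmul (E.q j) (E.q i) := by
    have := Set.ext_iff.1 h x
    simpa [smul, E.hg.idl, E.hg.idr] using this
  have h1 := E.q_notMem_hmul_q hij
  have h2 := E.q_notMem_q_hmul hij
  constructor
  · intro hm
    refine (hx.1 (Or.inr hm)).resolve_left ?_
    rintro rfl
    exact h1 hm
  · intro hm
    refine (hx.2 (Or.inr hm)).resolve_left ?_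
    rintro rfl
    exact h2 hm

/-- The family of factors `q i` for `i ∈ S` and `e` elsewhere. -/
def word (S : Finset (Fin E.n)) (i : Fin E.n) : H := if i ∈ S then E.q i else E.hg.e

theorem word_mem_gen (S : Finset (Fin E.n)) (i : Fin E.n) :
    E.word S i ∈ E.hg.gen {E.q i} := by
  rw [gen_singleton_q, word]; split <;> simp

theorem exists_eq_word {r : Fin E.n → H} (hr : ∀ i, r i ∈ E.hg.gen {E.q i}) :
    ∃ S, r = E.word S := by
  classical
  refine ⟨Finset.univ.filter fun i => r i = E.q i, funext fun i => ?_⟩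
  have h := hr i
  rw [gen_singleton_q] at h
  rcases h with h | h
  · have := (E.invol i).1
    simp [word, h, this.symm]
  · have h : r i = E.q i := h
    simp [word, h]

theorem hmul_word_comm (S T : Finset (Fin E.n)) (i j : Fin E.n) :
    E.hg.smul {E.word S i} {E.word T j} = E.hg.smul {E.word T j} {E.word S i} := by
  simp only [singleton_smul_singleton, word]
  split <;> split <;> simp [E.hg.idl, E.hg.idr, E.hmul_q_comm i j]

/-- The product of the `q i` for `i ∈ S`. -/
noncomputable def ofFinset (S : Finset (Fin E.n)) : H :=
  (E.hg.listProd_nonempty (E.word S) (List.finRange E.n)).some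

theorem famProd_word (S : Finset (Fin E.n)) : E.hg.famProd (E.word S) = {E.ofFinset S} := by
  have hx : E.ofFinset S ∈ E.hg.famProd (E.word S) :=
    (E.hg.listProd_nonempty (E.word S) (List.finRange E.n)).some_mem
  refine Set.Subset.antisymm (fun y hy => ?_) (by simpa using hx)
  rw [← E.constrained (E.ofFinset S)]
  exact ⟨_, ⟨E.word_mem_gen S, hx⟩, hy⟩

theorem ofFinset_surjective : Function.Surjective E.ofFinset := by
  intro x
  have hx : x ∈ E.hg.dcover (fun i => E.hg.gen {E.q i}) x := by
    rw [E.constrained x]; rfl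
  obtain ⟨r, ⟨hr, hx⟩, -⟩ := hx
  obtain ⟨S, rfl⟩ := E.exists_eq_word hr
  rw [famProd_word] at hx
  exact ⟨S, hx.symm⟩

theorem ofFinset_empty : E.ofFinset ∅ = E.hg.e := by
  have h : E.hg.e ∈ E.hg.famProd (E.word ∅) :=
    E.hg.e_mem_listProd _ _ fun i => by simp [word]
  rw [famProd_word] at h
  exact h.symm

theorem word_mem_hmul_word_iff (S T U : Finset (Fin E.n)) (i : Fin E.n) :
    E.word U i ∈ E.hg.hmul (E.word S i) (E.word T i) ↔
      (i ∈ S → i ∉ T → i ∈ U) ∧ (i ∉ S → i ∈ T → i ∈ U) ∧ (i ∉ S → i ∉ T → i ∉ U) ∧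
        (i ∈ S → i ∈ T → i ∈ U → E.hg.IsThick (E.q i)) := by
  have h1 := (E.invol i).1
  have h2 := (E.invol i).mem_hmul_self_iff
  have h3 := E.hg.e_mem_star_hmul (E.q i)
  rw [(E.invol i).star_eq] at h3
  by_cases hS : i ∈ S <;> by_cases hT : i ∈ T <;> by_cases hU : i ∈ U <;>
    simp [word, hS, hT, hU, E.hg.idl, E.hg.idr, h1, h1.symm, h2, h3]

theorem mem_hmul_iff_exists (S T : Finset (Fin E.n)) (x : H) :
    x ∈ E.hg.hmul (E.ofFinset S) (E.ofFinset T) ↔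
      ∃ U, (∀ i, E.word U i ∈ E.hg.hmul (E.word S i) (E.word T i)) ∧ x = E.ofFinset U := by
  rw [← singleton_smul_singleton, ← famProd_word, ← famProd_word, famProd, famProd,
    E.hg.listProd_smul_listProd _ _ _ (List.nodup_finRange _)
      fun i j _ => E.hmul_word_comm T S i j]
  simp only [singleton_smul_singleton]
  rw [E.hg.mem_listProd_iff _ _ (List.nodup_finRange _) fun i => E.hg.hmul_nonempty _ _]
  constructor
  · rintro ⟨r, hr, hx⟩
    have : ∀ i, r i ∈ E.hg.gen {E.q i} := by
      intro i
      have hG := (E.dp.1 i).1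
      have hS : E.hg.star (E.word S i) ∈ E.hg.gen {E.q i} :=
        hG.star_hmul_subset (E.word_mem_gen S i) hG.e_mem (by rw [E.hg.idr]; rfl)
      have hSS : E.hg.star (E.hg.star (E.word S i)) = E.word S i := by
        rw [eq_comm, ← E.hg.e_mem_hmul_iff]
        exact E.hg.e_mem_star_hmul _
      have := hG.star_hmul_subset hS (E.word_mem_gen T i)
      rw [hSS] at this
      exact this (hr i)
    obtain ⟨U, rfl⟩ := E.exists_eq_word this
    refine ⟨U, hr, ?_⟩
    have hx : x ∈ E.hg.famProd (E.word U) := hx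
    rwa [famProd_word] at hx
  · rintro ⟨U, hU, rfl⟩
    refine ⟨E.word U, hU, ?_⟩
    change _ ∈ E.hg.famProd (E.word U)
    rw [famProd_word]; rfl

theorem ofFinset_eq_e {U : Finset (Fin E.n)} (h : E.ofFinset U = E.hg.e) : U = ∅ := by
  rw [Finset.eq_empty_iff_forall_notMem]
  intro i hi
  have he : E.hg.e ∈ E.hg.famProd (E.word U) := by rw [famProd_word, h]; rfl
  rw [famProd, E.hg.listProd_eq_smul_filter _ _ (List.nodup_finRange _)
    (fun i j _ => E.hmul_word_comm U U i j) (List.mem_finRange i)] at he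
  obtain ⟨a, rfl, y, hy, he⟩ := he
  rw [E.hg.e_mem_hmul_iff] at he
  have hw : E.word U i = E.q i := by simp [word, hi]
  rw [hw, (E.invol i).star_eq] at he
  subst he
  exact E.q_notMem_cofactor i
    (E.hg.listProd_mono _ (fun j => by simpa using E.word_mem_gen U j) hy)

theorem ofFinset_injective : Function.Injective E.ofFinset := by
  intro S T h
  have he : E.hg.e ∈ E.hg.hmul (E.ofFinset S) (E.ofFinset S) := by
    rw [mem_hmul_iff_exists]
    refine ⟨∅, fun i => ?_, E.ofFinset_empty.symm⟩
    rw [word_mem_hmul_word_iff]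
    simp +contextual
  nth_rw 2 [h] at he
  obtain ⟨U, hU, he⟩ := (E.mem_hmul_iff_exists S T _).1 he
  obtain rfl := E.ofFinset_eq_e he.symm
  ext i
  have := (E.word_mem_hmul_word_iff S T ∅ i).1 (hU i)
  simp only [Finset.notMem_empty] at this
  tauto

theorem ofFinset_mem_hmul_iff (S T U : Finset (Fin E.n)) :
    E.ofFinset U ∈ E.hg.hmul (E.ofFinset S) (E.ofFinset T) ↔
      ∀ i, (i ∈ S → i ∉ T → i ∈ U) ∧ (i ∉ S → i ∈ T → i ∈ U) ∧ (i ∉ S → i ∉ T → i ∉ U) ∧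
        (i ∈ S → i ∈ T → i ∈ U → E.hg.IsThick (E.q i)) := by
  simp only [mem_hmul_iff_exists, word_mem_hmul_word_iff]
  constructor
  · rintro ⟨V, hV, h⟩
    rwa [E.ofFinset_injective h]
  · exact fun h => ⟨U, h, rfl⟩

theorem star_eq (x : H) : E.hg.star x = x := by
  obtain ⟨S, rfl⟩ := E.ofFinset_surjective x
  rw [eq_comm, ← E.hg.e_mem_hmul_iff, ← ofFinset_empty, ofFinset_mem_hmul_iff]
  simp +contextual

theorem isThin_ofFinset_iff (S : Finset (Fin E.n)) :
    E.hg.IsThin (E.ofFinset S) ↔ ∀ i ∈ S, ¬ E.hg.IsThick (E.q i) := by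
  rw [IsThin, star_eq]
  constructor
  · intro h i hi hK
    have : E.ofFinset {i} ∈ E.hg.hmul (E.ofFinset S) (E.ofFinset S) := by
      rw [ofFinset_mem_hmul_iff]
      intro j
      by_cases hj : j = i
      · subst hj; simp [hi, hK]
      · simp +contextual [hj]
    rw [h] at this
    simpa using E.ofFinset_eq_e this
  · intro h
    refine Set.Subset.antisymm (fun x hx => ?_) ?_
    · obtain ⟨U, rfl⟩ := E.ofFinset_surjective x
      rw [ofFinset_mem_hmul_iff] at hx
      have : U = ∅ := by
        rw [Finset.eq_empty_iff_forall_notMem]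
        intro i hi
        have := hx i
        have := h i
        tauto
      rw [this, ofFinset_empty]; rfl
    · have := E.hg.e_mem_star_hmul (E.ofFinset S)
      rw [star_eq] at this
      simpa using this

theorem support_ofFinset (S : Finset (Fin E.n)) :
    E.support (E.ofFinset S) = E.q '' (S : Set (Fin E.n)) := by
  ext y
  constructor
  · rintro ⟨hy, r, ⟨hr, hx⟩, i, rfl⟩
    obtain ⟨T, rfl⟩ := E.exists_eq_word hr
    rw [famProd_word] at hx
    obtain rfl := E.ofFinset_injective hx
    by_cases hi : i ∈ S
    · exact ⟨i, hi, by simp [word, hi]⟩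
    · simp [word, hi] at hy
  · rintro ⟨i, hi, rfl⟩
    have hi : i ∈ S := hi
    exact ⟨(E.invol i).1, E.word S, ⟨E.word_mem_gen S, by rw [famProd_word]; rfl⟩,
      i, by simp [word, hi]⟩

theorem sElem_ofFinset [DecidablePred fun i => E.hg.IsThick (E.q i)] (S : Finset (Fin E.n)) :
    E.sElem (E.ofFinset S) = (S.filter fun i => E.hg.IsThick (E.q i)).card := by
  have : {y ∈ E.support (E.ofFinset S) | E.hg.IsThick y} =
      E.q '' (S.filter fun i => E.hg.IsThick (E.q i) : Finset (Fin E.n)) := by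
    rw [support_ofFinset]
    ext y
    constructor
    · rintro ⟨⟨i, hi, rfl⟩, hy⟩
      exact ⟨i, by simpa using ⟨hi, hy⟩, rfl⟩
    · rintro ⟨i, hi, rfl⟩
      simp only [Finset.coe_filter, Set.mem_ofPred_eq] at hi
      exact ⟨⟨i, hi.1, rfl⟩, hi.2⟩
  rw [sElem, this, Set.ncard_image_of_injective _ E.q_injective, Set.ncard_coe_finset]

open Classical in
/-- The indices of thick factors occurring in some element of `G`. -/
noncomputable def thickIndices (G : Set H) : Finset (Fin E.n) :=
  Finset.univ.filter fun i => E.hg.IsThick (E.q i) ∧ ∃ S, E.ofFinset S ∈ G ∧ i ∈ S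

theorem mem_thickIndices {G : Set H} {i : Fin E.n} :
    i ∈ E.thickIndices G ↔ E.hg.IsThick (E.q i) ∧ ∃ S, E.ofFinset S ∈ G ∧ i ∈ S := by
  simp [thickIndices]

variable {E} {G : Set H}

theorem ofFinset_mem_of_mul (hG : E.hg.IsClosed G) {S T U : Finset (Fin E.n)}
    (hS : E.ofFinset S ∈ G) (hT : E.ofFinset T ∈ G)
    (h : ∀ i, (i ∈ S → i ∉ T → i ∈ U) ∧ (i ∉ S → i ∈ T → i ∈ U) ∧ (i ∉ S → i ∉ T → i ∉ U) ∧
        (i ∈ S → i ∈ T → i ∈ U → E.hg.IsThick (E.q i))) : E.ofFinset U ∈ G := by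
  refine hG.star_hmul_subset hS hT ?_
  rwa [star_eq, ofFinset_mem_hmul_iff]

theorem ofFinset_mem_of_subset_thickIndices (hG : E.hg.IsClosed G) {S : Finset (Fin E.n)}
    (hS : S ⊆ E.thickIndices G) : E.ofFinset S ∈ G := by
  induction S using Finset.induction_on with
  | empty => rw [ofFinset_empty]; exact hG.e_mem
  | insert i S hi ih =>
    rw [Finset.insert_subset_iff, mem_thickIndices] at hS
    obtain ⟨⟨hK, T, hT, hiT⟩, hS⟩ := hS
    have h1 : E.ofFinset {i} ∈ G := by
      refine ofFinset_mem_of_mul hG hT hT fun j => ?_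
      by_cases hj : j = i
      · subst hj; simp [hiT, hK]
      · simp +contextual [hj]
    refine ofFinset_mem_of_mul hG h1 (ih hS) fun j => ?_
    by_cases hj : j = i
    · subst hj; simp [hi]
    · simp +contextual [hj]

open Classical in
theorem filter_thick_subset_thickIndices {S : Finset (Fin E.n)} (hS : E.ofFinset S ∈ G) :
    (S.filter fun i => E.hg.IsThick (E.q i)) ⊆ E.thickIndices G := by
  intro i hi
  rw [Finset.mem_filter] at hi
  exact E.mem_thickIndices.2 ⟨hi.2, S, hS, hi.1⟩

open Classical in
theorem ofFinset_filter_thin_mem (hG : E.hg.IsClosed G) {S : Finset (Fin E.n)}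
    (hS : E.ofFinset S ∈ G) :
    E.ofFinset (S.filter fun i => ¬ E.hg.IsThick (E.q i)) ∈ G := by
  refine ofFinset_mem_of_mul hG hS
    (ofFinset_mem_of_subset_thickIndices hG (filter_thick_subset_thickIndices hS)) fun i => ?_
  simp only [Finset.mem_filter]
  tauto

theorem Osup_eq (hG : E.hg.IsClosed G) :
    E.hg.Osup G = E.ofFinset '' {S | S ⊆ E.thickIndices G} := by
  rw [Osup, hG.gen_eq]
  refine Set.Subset.antisymm (fun x hx => hx _ ⟨⟨⟨_, ∅, Finset.empty_subset _, rfl⟩, ?_⟩,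
    hG, ?_, ?_⟩) ?_
  · rintro x ⟨_, ⟨_, ⟨S, hS, rfl⟩, rfl⟩, _, ⟨T, hT, rfl⟩, hx⟩
    obtain ⟨U, rfl⟩ := E.ofFinset_surjective x
    rw [star_eq, ofFinset_mem_hmul_iff] at hx
    refine ⟨U, fun i hi => ?_, rfl⟩
    have h1 := hx i
    have h2 := @hS i
    have h3 := @hT i
    tauto
  · rintro x ⟨S, hS, rfl⟩
    exact ofFinset_mem_of_subset_thickIndices hG hS
  · rintro p hp x ⟨y, ⟨_, rfl, _, ⟨S, hS, rfl⟩, hy⟩, p', hp', hx⟩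
    obtain rfl : p' = p := hp'
    obtain ⟨T, rfl⟩ := E.ofFinset_surjective p'
    obtain ⟨V, rfl⟩ := E.ofFinset_surjective y
    obtain ⟨U, rfl⟩ := E.ofFinset_surjective x
    rw [star_eq, ofFinset_mem_hmul_iff] at hy
    rw [ofFinset_mem_hmul_iff] at hx
    refine ⟨U, fun i hi => ?_, rfl⟩
    by_contra hiM
    have hiS : i ∉ S := fun h => hiM (hS h)
    obtain ⟨hy1, -, hy2, -⟩ := hy i
    obtain ⟨-, -, hx1, hx2⟩ := hx i
    by_cases hiT : i ∈ T
    · exact hiM (E.mem_thickIndices.2 ⟨hx2 (hy1 hiT hiS) hiT hi, T, hp, hiT⟩)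
    · exact hx1 (hy2 hiT hiS) hiT hi
  · rintro x ⟨S, hS, rfl⟩ F ⟨hF, -, -, hn⟩
    have hsub : E.thickIndices G ⊆ E.thickIndices F := by
      intro i hi
      obtain ⟨hK, T, hT, hiT⟩ := E.mem_thickIndices.1 hi
      refine E.mem_thickIndices.2 ⟨hK, {i}, hn _ hT ⟨E.ofFinset T,
        ⟨_, rfl, _, hF.e_mem, by rw [star_eq, E.hg.idr]; rfl⟩, _, rfl, ?_⟩, by simp⟩
      rw [ofFinset_mem_hmul_iff]
      intro j
      by_cases hj : j = i
      · subst hj; simp [hiT, hK]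
      · simp +contextual [hj]
    exact ofFinset_mem_of_subset_thickIndices hF (hS.trans hsub)

theorem ncard_Osup (hG : E.hg.IsClosed G) :
    (E.hg.Osup G).ncard = 2 ^ (E.thickIndices G).card := by
  rw [Osup_eq hG, Set.ncard_image_of_injective _ E.ofFinset_injective, ← Finset.card_powerset,
    ← Set.ncard_coe_finset]
  congr 1
  ext S
  simp

theorem Othin_eq : E.hg.Othin G =
    E.ofFinset '' {S | E.ofFinset S ∈ G ∧ ∀ i ∈ S, ¬ E.hg.IsThick (E.q i)} := by
  ext x
  obtain ⟨S, rfl⟩ := E.ofFinset_surjective x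
  rw [E.ofFinset_injective.mem_set_image]
  exact and_congr_right fun _ => E.isThin_ofFinset_iff S

theorem smul_Osup_Othin (hG : E.hg.IsClosed G) :
    G = E.hg.smul (E.hg.Osup G) (E.hg.Othin G) := by
  classical
  rw [Osup_eq hG, Othin_eq]
  ext x
  constructor
  · intro hx
    obtain ⟨S, rfl⟩ := E.ofFinset_surjective x
    refine ⟨_, ⟨_, filter_thick_subset_thickIndices hx, rfl⟩,
      _, ⟨_, ⟨ofFinset_filter_thin_mem hG hx, by simp⟩, rfl⟩, ?_⟩
    rw [ofFinset_mem_hmul_iff]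
    intro i
    simp only [Finset.mem_filter]
    tauto
  · rintro ⟨_, ⟨S, hS, rfl⟩, _, ⟨T, ⟨hT, -⟩, rfl⟩, hx⟩
    have := hG.star_hmul_subset (ofFinset_mem_of_subset_thickIndices hG hS) hT
    rw [star_eq] at this
    exact this hx

theorem Osup_inter_Othin (hG : E.hg.IsClosed G) :
    E.hg.Osup G ∩ E.hg.Othin G = {E.hg.e} := by
  rw [Osup_eq hG, Othin_eq, ← Set.image_inter E.ofFinset_injective, ← ofFinset_empty,
    ← Set.image_singleton]
  congr 1
  ext S
  simp only [Set.mem_inter_iff, Set.mem_ofPred_eq, Set.mem_singleton_iff]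
  constructor
  · rintro ⟨h1, -, h2⟩
    rw [Finset.eq_empty_iff_forall_notMem]
    exact fun i hi => h2 i hi (E.mem_thickIndices.1 (h1 hi)).1
  · rintro rfl
    exact ⟨by simp, by rw [ofFinset_empty]; exact hG.e_mem, by simp⟩

theorem ncard_eq_ncard_Osup_mul_ncard_Othin (hG : E.hg.IsClosed G) :
    G.ncard = (E.hg.Osup G).ncard * (E.hg.Othin G).ncard := by
  classical
  rw [Osup_eq hG, Othin_eq, Set.ncard_image_of_injective _ E.ofFinset_injective,
    Set.ncard_image_of_injective _ E.ofFinset_injective, ← Set.ncard_prod,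
    ← Set.ncard_preimage_of_injective_subset_range E.ofFinset_injective
      (by simp [E.ofFinset_surjective.range_eq])]
  refine Set.ncard_congr (fun S _ => (S.filter fun i => E.hg.IsThick (E.q i),
    S.filter fun i => ¬ E.hg.IsThick (E.q i))) ?_ ?_ ?_
  · intro S hS
    exact ⟨filter_thick_subset_thickIndices hS, ofFinset_filter_thin_mem hG hS, by simp⟩
  · intro S T _ _ h
    rw [Prod.mk.injEq] at h
    rw [← Finset.filter_union_filter_not_eq (fun i => E.hg.IsThick (E.q i)) S, h.1, h.2,
      Finset.filter_union_filter_not_eq]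
  · rintro ⟨S, T⟩ ⟨hS, hT, hT'⟩
    have hSK : ∀ i ∈ S, E.hg.IsThick (E.q i) := fun i hi => (E.mem_thickIndices.1 (hS hi)).1
    refine ⟨S ∪ T, ofFinset_mem_of_mul hG (ofFinset_mem_of_subset_thickIndices hG hS) hT
      fun i => ?_, ?_⟩
    · have := hSK i
      simp only [Finset.mem_union]
      tauto
    · rw [Prod.mk.injEq]
      constructor
      · ext i
        have := hSK i
        have := hT' i
        simp only [Finset.mem_union, Finset.mem_filter]
        tauto
      · ext i
        have := hSK i
        have := hT' i
        simp only [Finset.mem_union, Finset.mem_filter]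
        tauto

theorem exists_ncard_Othin_eq_two_pow (hG : E.hg.IsClosed G) :
    ∃ k, (E.hg.Othin G).ncard = 2 ^ k := by
  rw [Othin_eq, Set.ncard_image_of_injective _ E.ofFinset_injective]
  let A : AddSubgroup (AsBoolRing (Finset (Fin E.n))) :=
    { carrier := {S | E.ofFinset (ofBoolRing S) ∈ G ∧
        ∀ i ∈ ofBoolRing S, ¬ E.hg.IsThick (E.q i)}
      zero_mem' := by
        refine ⟨?_, ?_⟩
        · rw [ofBoolRing_zero, Finset.bot_eq_empty, ofFinset_empty]
          exact hG.e_mem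
        · rw [ofBoolRing_zero]
          simp
      add_mem' := by
        rintro S T ⟨hS, hS'⟩ ⟨hT, hT'⟩
        refine ⟨ofFinset_mem_of_mul hG hS hT fun i => ?_, fun i => ?_⟩
        · rw [ofBoolRing_add, Finset.mem_symmDiff]
          tauto
        · rw [ofBoolRing_add, Finset.mem_symmDiff]
          have := hS' i
          have := hT' i
          tauto
      neg_mem' := by
        intro S hS
        exact hS }
  have hcard : Nat.card (AsBoolRing (Finset (Fin E.n))) = 2 ^ E.n := by
    change Nat.card (Finset (Fin E.n)) = _
    simp
  have hdvd := A.card_addSubgroup_dvd_card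
  rw [hcard, Nat.dvd_prime_pow Nat.prime_two] at hdvd
  obtain ⟨k, -, hk⟩ := hdvd
  exact ⟨k, hk⟩

theorem isClosed_Othin (hG : E.hg.IsClosed G) : E.hg.IsClosed (E.hg.Othin G) := by
  rw [Othin_eq]
  refine ⟨⟨_, ∅, ⟨by rw [ofFinset_empty]; exact hG.e_mem, by simp⟩, rfl⟩, ?_⟩
  rintro x ⟨_, ⟨_, ⟨S, ⟨hS, hS'⟩, rfl⟩, rfl⟩, _, ⟨T, ⟨hT, hT'⟩, rfl⟩, hx⟩
  obtain ⟨U, rfl⟩ := E.ofFinset_surjective x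
  rw [star_eq, ofFinset_mem_hmul_iff] at hx
  refine ⟨U, ⟨ofFinset_mem_of_mul hG hS hT hx, fun i hi => ?_⟩, rfl⟩
  have := hx i
  have := hS' i
  have := hT' i
  tauto

theorem finite (E : EA2Data H) : Finite H := Finite.of_surjective _ E.ofFinset_surjective

theorem ncard_Othin (hG : E.hg.IsClosed G) :
    (E.hg.Othin G).ncard = 2 ^ E.hg.rank2 G := by
  have := E.finite
  obtain ⟨k, hk⟩ := exists_ncard_Othin_eq_two_pow hG
  have hgr : IsGreatest {k | ∃ U : Set H, E.hg.IsClosed U ∧ U ⊆ G ∧ (∀ u ∈ U, E.hg.IsThin u) ∧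
      (∀ u ∈ U, E.hg.star u = u) ∧ U.ncard = 2 ^ k} k := by
    refine ⟨⟨E.hg.Othin G, isClosed_Othin hG, fun x hx => hx.1, fun x hx => hx.2,
      fun x _ => E.star_eq x, hk⟩, ?_⟩
    rintro m ⟨U, -, hUG, hU, -, hm⟩
    rw [← Nat.pow_le_pow_iff_right Nat.one_lt_two, ← hm, ← hk]
    exact Set.ncard_le_ncard fun x hx => ⟨hUG hx, hU x hx⟩
  rw [hk, rank2, hgr.csSup_eq]

theorem sSet_eq (hG : E.hg.IsClosed G) : E.sSet G = (E.thickIndices G).card := by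
  classical
  refine IsGreatest.csSup_eq ⟨⟨_, ofFinset_mem_of_subset_thickIndices hG subset_rfl, ?_⟩, ?_⟩
  · rw [sElem_ofFinset, Finset.filter_true_of_mem fun i hi => (E.mem_thickIndices.1 hi).1]
  · rintro k ⟨a, ha, rfl⟩
    obtain ⟨S, rfl⟩ := E.ofFinset_surjective a
    rw [sElem_ofFinset]
    exact Finset.card_le_card (filter_thick_subset_thickIndices ha)

theorem ncard_eq_two_pow (hG : E.hg.IsClosed G) :
    G.ncard = 2 ^ (E.sSet G + E.hg.rank2 G) := by
  rw [ncard_eq_ncard_Osup_mul_ncard_Othin hG, ncard_Osup hG, ncard_Othin hG, sSet_eq hG, pow_add]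

theorem sSet_univ (E : EA2Data H) : E.sSet Set.univ = E.psharp := by
  rw [sSet_eq isClosed_univ, psharp, ← Set.ncard_coe_finset]
  congr 1
  ext i
  simp only [Finset.mem_coe, mem_thickIndices, Set.mem_univ, true_and, Set.mem_ofPred_eq,
    and_iff_left_iff_imp]
  exact fun _ => ⟨{i}, by simp⟩

theorem rank2_univ (E : EA2Data H) : E.hg.rank2 Set.univ = E.n - E.psharp := by
  have h := ncard_eq_two_pow (E := E) isClosed_univ
  rw [Set.ncard_univ,
    ← Nat.card_congr (Equiv.ofBijective _ ⟨E.ofFinset_injective, E.ofFinset_surjective⟩),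
    sSet_univ] at h
  simp only [Nat.card_eq_fintype_card, Fintype.card_finset, Fintype.card_fin] at h
  have := Nat.pow_right_injective le_rfl h
  omega

end EA2Data

end HyperPaper

open HyperPaper

/-- For a closed subset G of an elementary abelian 2-hypergroup:
G = O^ϑ(G)·O_ϑ(G), O^ϑ(G) ∩ O_ϑ(G) = {e}, |G| = |O^ϑ(G)|·|O_ϑ(G)| = 2^{s(G)+r_2(G)};
in particular H = O^ϑ(H)·O_ϑ(H), O^ϑ(H) ∩ O_ϑ(H) = {e}, s(H) = p♯, r_2(H) = p − p♯. -/
theorem stmt7 {H : Type*} (E : EA2Data H) (G : Set H) (hG : E.hg.IsClosed G) :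
    G = E.hg.smul (E.hg.Osup G) (E.hg.Othin G) ∧
      E.hg.Osup G ∩ E.hg.Othin G = {E.hg.e} ∧
      G.ncard = (E.hg.Osup G).ncard * (E.hg.Othin G).ncard ∧
      G.ncard = 2 ^ (E.sSet G + E.hg.rank2 G) ∧
      (Set.univ : Set H) = E.hg.smul (E.hg.Osup Set.univ) (E.hg.Othin Set.univ) ∧
      E.hg.Osup Set.univ ∩ E.hg.Othin Set.univ = {E.hg.e} ∧
      E.sSet Set.univ = E.psharp ∧
      E.hg.rank2 Set.univ = E.n - E.psharp := by
  exact ⟨EA2Data.smul_Osup_Othin hG, EA2Data.Osup_inter_Othin hG,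
    EA2Data.ncard_eq_ncard_Osup_mul_ncard_Othin hG, EA2Data.ncard_eq_two_pow hG,
    EA2Data.smul_Osup_Othin Hypergroup.isClosed_univ,
    EA2Data.Osup_inter_Othin Hypergroup.isClosed_univ, E.sSet_univ, E.rank2_univ⟩
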